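/- arXiv:2401.10183 — 2 statements merged into one kernel-verified Lean document; each statement's English description precedes it below -/
import Mathlib

section
/- Let Λ be an invariant lattice and let Λ' be a maximal invariant lattice such that Λ ⊆ Λ' and Λ ⊄ πΛ'. Let φ : Λ/πΛ → Λ'/πΛ' be the F[G]-module map induced by the inclusion Λ ⊆ Λ'. Then the pair (ker φ, φ⁻¹(soc(Λ'/πΛ'))) is a sharp subquotient of Λ/πΛ. -/
noncomputable section

attribute [local instance] Classical.propDecidable

open Pointwise

/-! ### Generic machinery: modules equipped with a family of endomorphisms
indexed by a group `G` (i.e. "`R[G]`-modules"). -/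

section Generic

variable {R : Type*} [CommRing R] {M : Type*} [AddCommGroup M] [Module R M]
variable {G : Type*}

/-- A submodule stable under all the endomorphisms `σ g`. -/
def ActStable (σ : G → M →ₗ[R] M) (W : Submodule R M) : Prop :=
  ∀ g : G, ∀ x ∈ W, σ g x ∈ W

/-- The subquotient `W₂ / W₁`. -/
abbrev SubQuot (W₁ W₂ : Submodule R M) : Type _ :=
  W₂ ⧸ (W₁.comap W₂.subtype)

/-- The endomorphism of `W₂/W₁` induced by `σ g` (junk value `0` if `σ g` does not
preserve `W₁` and `W₂`). -/
noncomputable def subQuotMap (σ : G → M →ₗ[R] M) (W₁ W₂ : Submodule R M) (g : G) :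
    SubQuot W₁ W₂ →ₗ[R] SubQuot W₁ W₂ :=
  if h : (∀ x ∈ W₂, σ g x ∈ W₂) ∧ ∀ x ∈ W₂, x ∈ W₁ → σ g x ∈ W₁ then
    Submodule.mapQ _ _ ((σ g).restrict (p := W₂) (q := W₂) h.1)
      (by intro x hx; exact h.2 x x.2 hx)
  else 0

/-- The endomorphism of a stable submodule `W` induced by `σ g`. -/
noncomputable def subAct (σ : G → M →ₗ[R] M) (W : Submodule R M) (g : G) : W →ₗ[R] W :=
  if h : ∀ x ∈ W, σ g x ∈ W then (σ g).restrict h else 0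

/-- The endomorphism of `M ⧸ W` induced by `σ g`. -/
noncomputable def quotMap (σ : G → M →ₗ[R] M) (W : Submodule R M) (g : G) :
    (M ⧸ W) →ₗ[R] (M ⧸ W) :=
  if h : W ≤ W.comap (σ g) then Submodule.mapQ W W (σ g) h else 0

/-- Two modules-with-`G`-action are isomorphic: there is a linear equivalence
commuting with the two actions. -/
def IsRepIso {N : Type*} [AddCommGroup N] [Module R N]
    (σ : G → M →ₗ[R] M) (τ : G → N →ₗ[R] N) : Prop :=
  ∃ e : M ≃ₗ[R] N, ∀ (g : G) (x : M), e (σ g x) = τ g (e x)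

/-- `M` with the action `σ` is a simple module-with-action. -/
def IsSimpleAct (σ : G → M →ₗ[R] M) : Prop :=
  Nontrivial M ∧ ∀ W : Submodule R M, ActStable σ W → W = ⊥ ∨ W = ⊤

/-- `W` is a simple stable submodule of `M`. -/
def IsSimpleSubmodule (σ : G → M →ₗ[R] M) (W : Submodule R M) : Prop :=
  ActStable σ W ∧ W ≠ ⊥ ∧ ∀ U : Submodule R M, ActStable σ U → U ≤ W → U = ⊥ ∨ U = W

/-- The socle: the sum of all simple stable submodules. -/
def actSocle (σ : G → M →ₗ[R] M) : Submodule R M :=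
  sSup {W | IsSimpleSubmodule σ W}

/-- The socle filtration: `socFilt σ 0 = ⊥` and `socFilt σ (k+1)` is the preimage in `M`
of the socle of `M / socFilt σ k`. -/
noncomputable def socFilt (σ : G → M →ₗ[R] M) : ℕ → Submodule R M
  | 0 => ⊥
  | k + 1 => (actSocle (quotMap σ (socFilt σ k))).comap (socFilt σ k).mkQ

/-- `(A₁, A₂)` is a sharp subquotient: every stable submodule strictly containing `A₁`
contains `A₂`. -/
def IsSharp (σ : G → M →ₗ[R] M) (A₁ A₂ : Submodule R M) : Prop :=
  ActStable σ A₁ ∧ ActStable σ A₂ ∧ A₁ < A₂ ∧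
    ∀ W : Submodule R M, ActStable σ W → A₁ < W → A₂ ≤ W

/-- `(A₁, A₂)` is an irreducible subquotient: `A₂/A₁` is simple, i.e. there is no stable
submodule strictly between `A₁` and `A₂`. -/
def IsIrredSubquot (σ : G → M →ₗ[R] M) (A₁ A₂ : Submodule R M) : Prop :=
  ActStable σ A₁ ∧ ActStable σ A₂ ∧ A₁ < A₂ ∧
    ∀ W : Submodule R M, ActStable σ W → A₁ ≤ W → W ≤ A₂ → W = A₁ ∨ W = A₂

end Generic

/-! ### Lattices in representations over a discretely valued field -/

section LatticeDefs

variable {O : Type*} [CommRing O]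
variable {V : Type*} [AddCommGroup V] [Module O V]

/-- A lattice: a finitely generated `O`-submodule of `V` spanning `V` over `K`. -/
def IsLattice (K : Type*) [Field K] [Module K V] (Λ : Submodule O V) : Prop :=
  Λ.FG ∧ Submodule.span K (Λ : Set V) = ⊤

/-- Two lattices are homothetic: `Λ' = λ • Λ` for some nonzero `λ ∈ K`. -/
def Homothetic (K : Type*) [Field K] [SMul K V] (Λ Λ' : Submodule O V) : Prop :=
  ∃ lam : K, lam ≠ 0 ∧ (Λ' : Set V) = lam • (Λ : Set V)

end LatticeDefs

section Lattices

variable {O : Type*} [CommRing O] [IsDomain O] [IsDiscreteValuationRing O]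
variable {K : Type*} [Field K] [Algebra O K] [IsFractionRing O K]
variable {G : Type*} [Group G]
variable {V : Type*} [AddCommGroup V] [Module K V] [Module O V] [IsScalarTower O K V]

/-- The submodule `πΛ`. -/
def piSmul (π : O) (Λ : Submodule O V) : Submodule O V :=
  Λ.map (LinearMap.lsmul O V π)

/-- The `O`-linear `G`-action on `V`. -/
def resAct (ρ : Representation K G V) : G → V →ₗ[O] V :=
  fun g => (ρ g).restrictScalars O

/-- `Λ` is invariant: `gΛ = Λ` for all `g ∈ G`. -/
def IsInvariantSub (ρ : Representation K G V) (Λ : Submodule O V) : Prop :=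
  ∀ g : G, Λ.map (resAct ρ g) = Λ

/-- `Λ` is normalised at `v`: `v ∈ Λ` and `v ∉ πΛ`. -/
def IsNormalizedAt (π : O) (Λ : Submodule O V) (v : V) : Prop :=
  v ∈ Λ ∧ v ∉ piSmul π Λ

/-- `Λ` is an invariant lattice, normalised at `v`, maximal under inclusion among
invariant lattices normalised at `v`. -/
def IsMaximalAt (ρ : Representation K G V) (π : O) (Λ : Submodule O V) (v : V) : Prop :=
  IsLattice K Λ ∧ IsInvariantSub ρ Λ ∧ IsNormalizedAt π Λ v ∧
    ∀ Λ' : Submodule O V, IsLattice K Λ' → IsInvariantSub ρ Λ' → IsNormalizedAt π Λ' v →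
      Λ ≤ Λ' → Λ' = Λ

/-- `Λ` is a maximal invariant lattice: maximal with respect to some nonzero `v`. -/
def IsMaximalLattice (ρ : Representation K G V) (π : O) (Λ : Submodule O V) : Prop :=
  ∃ v : V, v ≠ 0 ∧ IsMaximalAt ρ π Λ v

/-- `V` is simple as a `K[G]`-module. -/
def IsIrreducibleRep (ρ : Representation K G V) : Prop :=
  Nontrivial V ∧ ∀ W : Submodule K V, (∀ g : G, ∀ x ∈ W, ρ g x ∈ W) → W = ⊥ ∨ W = ⊤

/-- The induced `G`-action on the reduction `Λ/πΛ`. -/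
noncomputable def redAct (ρ : Representation K G V) (π : O) (Λ : Submodule O V) :
    G → SubQuot (piSmul π Λ) Λ →ₗ[O] SubQuot (piSmul π Λ) Λ :=
  subQuotMap (resAct ρ) (piSmul π Λ) Λ

/-- The map `Λ/πΛ → Λ'/πΛ'` induced by an inclusion `Λ ≤ Λ'` (junk value `0` if
`Λ ≰ Λ'`). -/
noncomputable def redMap (π : O) (Λ Λ' : Submodule O V) :
    SubQuot (piSmul π Λ) Λ →ₗ[O] SubQuot (piSmul π Λ') Λ' :=
  if h : Λ ≤ Λ' then
    Submodule.mapQ _ _ (Submodule.inclusion h)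
      (by
        intro x hx
        have hx' : (x : V) ∈ piSmul π Λ := hx
        have : (x : V) ∈ piSmul π Λ' := Submodule.map_mono h hx'
        simpa [Submodule.mem_comap] using this)
  else 0

/-- `ρ` realises a non-split extension of `A` (a module with action `τA`) by `B`
(a module with action `τB`): there are an invariant lattice `L` and submodules
`U₀ ⊆ T ⊆ U₁` of `L/πL` with `T/U₀ ≅ B`, `U₁/T ≅ A`, and `T/U₀` has no stable
complement in `U₁/U₀` (i.e. the extension `0 → B → U₁/U₀ → A → 0` does not split). -/
def RealizesExt (ρ : Representation K G V) (π : O)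
    {NA : Type*} [AddCommGroup NA] [Module O NA] {NB : Type*} [AddCommGroup NB] [Module O NB]
    (τA : G → NA →ₗ[O] NA) (τB : G → NB →ₗ[O] NB) : Prop :=
  ∃ L : Submodule O V, IsLattice K L ∧ IsInvariantSub ρ L ∧
    ∃ U₀ U₁ T : Submodule O (SubQuot (piSmul π L) L),
      ActStable (redAct ρ π L) U₀ ∧ ActStable (redAct ρ π L) U₁ ∧
      ActStable (redAct ρ π L) T ∧ U₀ ≤ T ∧ T ≤ U₁ ∧
      IsRepIso (subQuotMap (redAct ρ π L) U₀ T) τB ∧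
      IsRepIso (subQuotMap (redAct ρ π L) T U₁) τA ∧
      ¬ ∃ C : Submodule O (SubQuot (piSmul π L) L), ActStable (redAct ρ π L) C ∧
          U₀ ≤ C ∧ C ≤ U₁ ∧ C ⊓ T = U₀ ∧ C ⊔ T = U₁

end Lattices

/-- The underlying family of linear endomorphisms of a representation. -/
def ofRep {R : Type*} [CommSemiring R] {G : Type*} [Monoid G] {M : Type*} [AddCommMonoid M]
    [Module R M] (σ : Representation R G M) : G → M →ₗ[R] M := fun g => σ g

section Socle

variable {R : Type*} [CommRing R] {M : Type*} [AddCommGroup M] [Module R M]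
variable {N : Type*} [AddCommGroup N] [Module R N] {G : Type*}

lemma subQuotMap_mk (σ : G → M →ₗ[R] M) (W₁ W₂ : Submodule R M) (g : G)
    (h₂ : ∀ x ∈ W₂, σ g x ∈ W₂) (h₁ : ∀ x ∈ W₂, x ∈ W₁ → σ g x ∈ W₁) (x : W₂) :
    subQuotMap σ W₁ W₂ g (Submodule.Quotient.mk x) =
      Submodule.Quotient.mk ⟨σ g x, h₂ x x.2⟩ := by
  rw [subQuotMap, dif_pos ⟨h₂, h₁⟩]
  rfl

lemma ActStable.sInf {σ : G → M →ₗ[R] M} {s : Set (Submodule R M)}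
    (hs : ∀ W ∈ s, ActStable σ W) : ActStable σ (sInf s) := by
  intro g x hx
  rw [Submodule.mem_sInf] at hx ⊢
  exact fun W hW => hs W hW g x (hx W hW)

lemma ActStable.map {σ : G → M →ₗ[R] M} {τ : G → N →ₗ[R] N} {φ : M →ₗ[R] N}
    (hφ : ∀ g x, φ (σ g x) = τ g (φ x)) {W : Submodule R M} (hW : ActStable σ W) :
    ActStable τ (W.map φ) := by
  rintro g _ ⟨x, hx, rfl⟩
  exact ⟨σ g x, hW g x hx, hφ g x⟩

lemma ActStable.comap {σ : G → M →ₗ[R] M} {τ : G → N →ₗ[R] N} {φ : M →ₗ[R] N}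
    (hφ : ∀ g x, φ (σ g x) = τ g (φ x)) {W : Submodule R N} (hW : ActStable τ W) :
    ActStable σ (W.comap φ) := by
  intro g x hx
  rw [Submodule.mem_comap, hφ]
  exact hW g _ hx

/-- If some nonzero vector lies in every nonzero stable submodule, the socle is the smallest
nonzero stable submodule. -/
lemma isLeast_actSocle {τ : G → N →ₗ[R] N} {v : N} (hv : v ≠ 0)
    (hmem : ∀ S : Submodule R N, ActStable τ S → S ≠ ⊥ → v ∈ S) :
    IsLeast {S : Submodule R N | ActStable τ S ∧ S ≠ ⊥} (actSocle τ) := by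
  set D : Submodule R N := sInf {S | ActStable τ S ∧ S ≠ ⊥} with hD
  have hDst : ActStable τ D := ActStable.sInf fun W hW => hW.1
  have hDbot : D ≠ ⊥ := by
    have hvD : v ∈ D := by
      rw [hD, Submodule.mem_sInf]
      exact fun S hS => hmem S hS.1 hS.2
    exact fun h => hv (by simpa [h] using hvD)
  have hDle : ∀ S : Submodule R N, ActStable τ S → S ≠ ⊥ → D ≤ S :=
    fun S h₁ h₂ => sInf_le ⟨h₁, h₂⟩
  have hsoc : actSocle τ = D := by
    apply le_antisymm
    · refine sSup_le fun S hS => ?_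
      exact ((hS.2.2 D hDst (hDle S hS.1 hS.2.1)).resolve_left hDbot).ge
    · refine le_sSup ⟨hDst, hDbot, fun U hU hUD => ?_⟩
      by_cases h : U = ⊥
      · exact Or.inl h
      · exact Or.inr (le_antisymm hUD (hDle U hU h))
  rw [hsoc]
  exact ⟨⟨hDst, hDbot⟩, fun S hS => hDle S hS.1 hS.2⟩

lemma isSharp_ker_comap_actSocle {σ : G → M →ₗ[R] M} {τ : G → N →ₗ[R] N} {φ : M →ₗ[R] N}
    (hφ : ∀ g x, φ (σ g x) = τ g (φ x)) (hφ0 : φ ≠ 0) {v : N} (hv : v ≠ 0)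
    (hmem : ∀ S : Submodule R N, ActStable τ S → S ≠ ⊥ → v ∈ S) :
    IsSharp σ (LinearMap.ker φ) ((actSocle τ).comap φ) := by
  obtain ⟨⟨hst, hbot⟩, hleast⟩ := isLeast_actSocle hv hmem
  have hker : ActStable σ (LinearMap.ker φ) := by
    intro g x hx
    rw [LinearMap.mem_ker] at hx ⊢
    rw [hφ, hx, map_zero]
  have hcontains : ∀ W : Submodule R M, ActStable σ W → W.map φ ≠ ⊥ →
      actSocle τ ≤ W.map φ := fun W hW h => hleast ⟨hW.map hφ, h⟩
  refine ⟨hker, hst.comap hφ, ?_, fun W hW hlt => ?_⟩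
  · refine lt_of_le_not_ge (LinearMap.ker_le_comap φ) fun hle => hbot ?_
    have htop : actSocle τ ≤ (⊤ : Submodule R M).map φ := by
      refine hcontains ⊤ (fun _ _ _ => Submodule.mem_top) ?_
      rwa [Submodule.map_top, Ne, LinearMap.range_eq_bot]
    rw [eq_bot_iff]
    intro y hy
    obtain ⟨x, -, rfl⟩ := htop hy
    exact hle hy
  · have hW0 : W.map φ ≠ ⊥ := fun h =>
      hlt.not_ge (LinearMap.le_ker_iff_map.mpr h)
    calc (actSocle τ).comap φ ≤ (W.map φ).comap φ := Submodule.comap_mono (hcontains W hW hW0)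
      _ = W := by rw [Submodule.comap_map_eq, sup_eq_left.mpr hlt.le]

end Socle

section InvariantLattices

variable {O : Type*} [CommRing O]
variable {K : Type*} [Field K] [Algebra O K]
variable {G : Type*} [Group G]
variable {V : Type*} [AddCommGroup V] [Module K V] [Module O V] [IsScalarTower O K V]

lemma isInvariantSub_iff_actStable {ρ : Representation K G V} {Λ : Submodule O V} :
    IsInvariantSub ρ Λ ↔ ActStable (resAct ρ) Λ := by
  constructor
  · intro h g x hx
    rw [← h g]
    exact Submodule.mem_map_of_mem hx
  · intro h g
    apply le_antisymm
    · rintro _ ⟨x, hx, rfl⟩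
      exact h g x hx
    · intro x hx
      exact ⟨resAct ρ g⁻¹ x, h g⁻¹ x hx, by simp [resAct]⟩

lemma ActStable.piSmul {ρ : Representation K G V} {Λ : Submodule O V}
    (h : ActStable (resAct ρ) Λ) (π : O) : ActStable (resAct ρ) (piSmul π Λ) :=
  h.map (φ := LinearMap.lsmul O V π) fun g x => by simp

lemma piSmul_le (π : O) (Λ : Submodule O V) : piSmul π Λ ≤ Λ := by
  rintro _ ⟨x, hx, rfl⟩
  exact Λ.smul_mem π hx

lemma redAct_mk {ρ : Representation K G V} {Λ : Submodule O V} (h : ActStable (resAct ρ) Λ)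
    (π : O) (g : G) (x : Λ) :
    redAct ρ π Λ g (Submodule.Quotient.mk x) =
      Submodule.Quotient.mk ⟨resAct ρ g x, h g x x.2⟩ :=
  subQuotMap_mk _ _ _ _ _ (fun y _ hy => h.piSmul π g y hy) x

lemma redMap_mk {Λ Λ' : Submodule O V} (h : Λ ≤ Λ') (π : O) (x : Λ) :
    redMap π Λ Λ' (Submodule.Quotient.mk x) = Submodule.Quotient.mk ⟨x, h x.2⟩ := by
  rw [redMap, dif_pos h]
  rfl

lemma redMap_redAct {ρ : Representation K G V} {Λ Λ' : Submodule O V}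
    (hΛ : ActStable (resAct ρ) Λ) (hΛ' : ActStable (resAct ρ) Λ') (h : Λ ≤ Λ') (π : O) (g : G)
    (x : SubQuot (piSmul π Λ) Λ) :
    redMap π Λ Λ' (redAct ρ π Λ g x) = redAct ρ π Λ' g (redMap π Λ Λ' x) := by
  obtain ⟨x, rfl⟩ := Submodule.Quotient.mk_surjective _ x
  rw [redAct_mk hΛ, redMap_mk h, redMap_mk h, redAct_mk hΛ']

lemma redMap_ne_zero {Λ Λ' : Submodule O V} (h : Λ ≤ Λ') {π : O} (hns : ¬ Λ ≤ piSmul π Λ') :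
    redMap π Λ Λ' ≠ 0 := by
  obtain ⟨x, hx, hx'⟩ := SetLike.not_le_iff_exists.mp hns
  intro h0
  have hmk := redMap_mk h π ⟨x, hx⟩
  rw [h0, LinearMap.zero_apply, eq_comm, Submodule.Quotient.mk_eq_zero] at hmk
  exact hx' hmk

lemma lsmul_bijective_of_fractionField [IsFractionRing O K] {π : O} (hπ : π ≠ 0) :
    Function.Bijective (LinearMap.lsmul O V π) := by
  have hπK : algebraMap O K π ≠ 0 := by
    rwa [Ne, IsFractionRing.to_map_eq_zero_iff]
  have hsmul : ⇑(LinearMap.lsmul O V π) = fun x => algebraMap O K π • x := by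
    ext x
    simp
  rw [hsmul]
  exact MulAction.bijective₀ hπK

/-- The reduction of a lattice maximal at `v` has the image of `v` in each of its nonzero stable
submodules. -/
lemma IsMaximalAt.mk_mem_of_actStable [IsNoetherianRing O] [IsFractionRing O K]
    {ρ : Representation K G V} {π : O} (hπ : π ≠ 0) {Λ : Submodule O V} {v : V}
    (h : IsMaximalAt ρ π Λ v) {S : Submodule O (SubQuot (piSmul π Λ) Λ)}
    (hS : ActStable (redAct ρ π Λ) S) (hS0 : S ≠ ⊥) :
    Submodule.Quotient.mk ⟨v, h.2.2.1.1⟩ ∈ S := by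
  obtain ⟨⟨hfg, hspan⟩, hinv, ⟨hv, -⟩, hmax⟩ := h
  have hst := isInvariantSub_iff_actStable.mp hinv
  have hbij := lsmul_bijective_of_fractionField (K := K) (V := V) hπ
  set L : Submodule O V := (S.comap (Submodule.mkQ _)).map Λ.subtype with hL
  have hmemL : ∀ x (hx : x ∈ Λ), x ∈ L ↔ Submodule.Quotient.mk ⟨x, hx⟩ ∈ S := by
    intro x hx
    simp [hL, hx]
  have hLΛ : L ≤ Λ := Submodule.map_subtype_le _ _
  have hπL : piSmul π Λ ≤ L := by
    intro x hx
    rw [hmemL x (piSmul_le π Λ hx)]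
    convert S.zero_mem
    rwa [Submodule.Quotient.mk_eq_zero]
  have hLst : ActStable (resAct ρ) L := by
    intro g x hx
    rw [hmemL _ (hst g x (hLΛ hx))]
    rw [hmemL x (hLΛ hx)] at hx
    have := hS g _ hx
    rwa [redAct_mk hst] at this
  by_contra hvS
  have hvL : v ∉ L := fun hvL => hvS ((hmemL v hv).mp hvL)
  set P : Submodule O V := L.comap (LinearMap.lsmul O V π) with hP
  have hmapP : piSmul π P ≤ L := Submodule.map_comap_le _ _
  have hΛP : Λ ≤ P := Submodule.map_le_iff_le_comap.mp hπL
  have hPfg : P.FG := by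
    refine Submodule.fg_of_fg_map_injective _ hbij.1 ?_
    exact Submodule.FG.of_le hfg (hmapP.trans hLΛ)
  have hPΛ : P = Λ := by
    refine hmax P ⟨hPfg, ?_⟩ ?_ ⟨hΛP hv, fun hvP => hvL (hmapP hvP)⟩ hΛP
    · exact top_le_iff.mp (hspan.ge.trans (Submodule.span_mono hΛP))
    · rw [isInvariantSub_iff_actStable]
      exact hLst.comap fun g x => by simp
  apply hS0
  rw [eq_bot_iff]
  intro y hy
  obtain ⟨⟨x, hx⟩, rfl⟩ := Submodule.Quotient.mk_surjective _ y
  obtain ⟨z, rfl⟩ := hbij.2 x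
  have hz : z ∈ P := (hmemL _ hx).mpr hy
  rw [hPΛ] at hz
  rw [Submodule.mem_bot, Submodule.Quotient.mk_eq_zero]
  exact Submodule.mem_map_of_mem hz

end InvariantLattices

section Statement

variable {O : Type*} [CommRing O] [IsDomain O] [IsDiscreteValuationRing O]
variable {K : Type*} [Field K] [Algebra O K] [IsFractionRing O K]
variable {G : Type*} [Group G]
variable {V : Type*} [AddCommGroup V] [Module K V] [Module O V] [IsScalarTower O K V]
variable [FiniteDimensional K V]

theorem statement_6 (π : O) (hπ : Irreducible π) (ρ : Representation K G V)
    (Λ Λ' : Submodule O V) (hlat : IsLattice K Λ) (hinv : IsInvariantSub ρ Λ)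
    (hmax : IsMaximalLattice ρ π Λ') (hle : Λ ≤ Λ') (hns : ¬ Λ ≤ piSmul π Λ') :
    IsSharp (redAct ρ π Λ) (LinearMap.ker (redMap π Λ Λ'))
      ((actSocle (redAct ρ π Λ')).comap (redMap π Λ Λ')) := by
  obtain ⟨v, -, hv⟩ := hmax
  have hΛ := isInvariantSub_iff_actStable.mp hinv
  have hΛ' := isInvariantSub_iff_actStable.mp hv.2.1
  refine isSharp_ker_comap_actSocle (redMap_redAct hΛ hΛ' hle π) (redMap_ne_zero hle hns)
    (v := Submodule.Quotient.mk ⟨v, hv.2.2.1.1⟩) ?_ fun S hS hS0 =>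
      hv.mk_mem_of_actStable hπ.ne_zero hS hS0
  rw [Ne, Submodule.Quotient.mk_eq_zero]
  exact hv.2.2.1.2

end Statement
end
end

section
/- Let M be a finite-dimensional F[G]-module, let m ≥ 2, and let W be a simple F[G]-submodule of soc^m(M)/soc^{m-1}(M). Then there exist a simple F[G]-submodule U of soc^{m-1}(M)/soc^{m-2}(M) and F[G]-submodules V₁ ⊆ V₂ of M with soc^{m-2}(M) ⊆ V₁ ⊆ soc^{m-1}(M) and V₂ ⊆ soc^m(M), together with a short exact sequence 0 → U' → V₂/V₁ → W' → 0 of F[G]-modules that does not split, where U' ≅ U and W' ≅ W. -/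
noncomputable section

attribute [local instance] Classical.propDecidable

open Pointwise

section Subquotients

variable {R : Type*} [CommRing R] {M : Type*} [AddCommGroup M] [Module R M]
variable {G : Type*} {σ : G → M →ₗ[R] M}

theorem ActStable.sup {A B : Submodule R M} (hA : ActStable σ A) (hB : ActStable σ B) :
    ActStable σ (A ⊔ B) := by
  intro g x hx
  obtain ⟨a, ha, b, hb, rfl⟩ := Submodule.mem_sup.1 hx
  rw [map_add]
  exact Submodule.add_mem_sup (hA g a ha) (hB g b hb)

theorem ActStable.inf {A B : Submodule R M} (hA : ActStable σ A) (hB : ActStable σ B) :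
    ActStable σ (A ⊓ B) :=
  fun g x hx => ⟨hA g x hx.1, hB g x hx.2⟩

theorem actStable_sSup {S : Set (Submodule R M)} (hS : ∀ A ∈ S, ActStable σ A) :
    ActStable σ (sSup S) := by
  intro g
  suffices h : sSup S ≤ (sSup S).comap (σ g) from fun x hx => h hx
  exact sSup_le fun A hA x hx => le_sSup hA (hS A hA g x hx)

theorem quotMap_mkQ {P : Submodule R M} (hP : ActStable σ P) (g : G) (x : M) :
    quotMap σ P g (P.mkQ x) = P.mkQ (σ g x) := by
  have h : P ≤ P.comap (σ g) := fun x hx => hP g x hx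
  simp [quotMap, h]

theorem subQuotMap_mkQ {P Q : Submodule R M} (hP : ActStable σ P) (hQ : ActStable σ Q)
    (g : G) (x : Q) :
    subQuotMap σ P Q g ((P.comap Q.subtype).mkQ x) =
      (P.comap Q.subtype).mkQ ⟨σ g x, hQ g x x.2⟩ := by
  have h : (∀ x ∈ Q, σ g x ∈ Q) ∧ ∀ x ∈ Q, x ∈ P → σ g x ∈ P :=
    ⟨hQ g, fun x _ hx => hP g x hx⟩
  rw [subQuotMap, dif_pos h]
  rfl

theorem coe_subAct {P : Submodule R M} (hP : ActStable σ P) (g : G) (x : P) :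
    (subAct σ P g x : M) = σ g x := by
  rw [subAct, dif_pos (hP g)]
  rfl

theorem ActStable.comap_mkQ {P : Submodule R M} (hP : ActStable σ P)
    {Y : Submodule R (M ⧸ P)} (hY : ActStable (quotMap σ P) Y) :
    ActStable σ (Y.comap P.mkQ) := by
  intro g x hx
  rw [Submodule.mem_comap, ← quotMap_mkQ hP]
  exact hY g _ hx

theorem ActStable.map_mkQ {P D : Submodule R M} (hP : ActStable σ P) (hD : ActStable σ D) :
    ActStable (quotMap σ P) (D.map P.mkQ) := by
  rintro g _ ⟨x, hx, rfl⟩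
  rw [quotMap_mkQ hP]
  exact ⟨_, hD g x hx, rfl⟩

theorem actStable_actSocle : ActStable σ (actSocle σ) :=
  actStable_sSup fun _ hA => hA.1

theorem actStable_socFilt (k : ℕ) : ActStable σ (socFilt σ k) := by
  induction k with
  | zero => intro g x hx; simp_all [socFilt]
  | succ k ih => exact ih.comap_mkQ actStable_actSocle

theorem IsIrredSubquot.isSimpleSubmodule_map_mkQ {P D : Submodule R M}
    (h : IsIrredSubquot σ P D) : IsSimpleSubmodule (quotMap σ P) (D.map P.mkQ) := by
  obtain ⟨hP, hD, hlt, hmin⟩ := h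
  refine ⟨hP.map_mkQ hD, fun h0 => ?_, fun Y hY hYD => ?_⟩
  · have hDP := LinearMap.le_ker_iff_map.2 h0
    rw [Submodule.ker_mkQ] at hDP
    exact hlt.not_ge hDP
  · have hle : Y.comap P.mkQ ≤ D := by
      refine (Submodule.comap_mono hYD).trans ?_
      rw [Submodule.comap_map_mkQ]
      exact sup_le hlt.le le_rfl
    have hPY : P ≤ Y.comap P.mkQ := Submodule.le_comap_mkQ P Y
    have hmap : (Y.comap P.mkQ).map P.mkQ = Y :=
      Submodule.map_comap_eq_of_surjective P.mkQ_surjective Y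
    refine (hmin _ (hP.comap_mkQ hY) hPY hle).imp (fun h => ?_) fun h => ?_
    · rw [← hmap, h, Submodule.mkQ_map_self]
    · rw [← hmap, h]

theorem IsSimpleSubmodule.isIrredSubquot_comap_mkQ {P : Submodule R M} (hP : ActStable σ P)
    {Y : Submodule R (M ⧸ P)} (hY : IsSimpleSubmodule (quotMap σ P) Y) :
    IsIrredSubquot σ P (Y.comap P.mkQ) := by
  obtain ⟨hYs, hne, hmin⟩ := hY
  have hmap : (Y.comap P.mkQ).map P.mkQ = Y :=
    Submodule.map_comap_eq_of_surjective P.mkQ_surjective Y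
  have hPY : P ≤ Y.comap P.mkQ := Submodule.le_comap_mkQ P Y
  refine ⟨hP, hP.comap_mkQ hYs, lt_of_le_of_ne hPY fun h => hne ?_, fun X hX hPX hXY => ?_⟩
  · rw [← hmap, ← h, Submodule.mkQ_map_self]
  · have hX' : (X.map P.mkQ).comap P.mkQ = X := by
      rw [Submodule.comap_map_mkQ, sup_eq_right.2 hPX]
    refine (hmin _ (hP.map_mkQ hX) (Submodule.map_le_iff_le_comap.2 hXY)).imp
      (fun h => ?_) fun h => ?_
    · rw [← hX', h, Submodule.comap_bot, Submodule.ker_mkQ]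
    · rw [← hX', h]

theorem socFilt_le_succ (k : ℕ) : socFilt σ k ≤ socFilt σ (k + 1) :=
  Submodule.le_comap_mkQ _ _

theorem IsIrredSubquot.le_socFilt_succ {k : ℕ} {D : Submodule R M}
    (h : IsIrredSubquot σ (socFilt σ k) D) : D ≤ socFilt σ (k + 1) :=
  Submodule.map_le_iff_le_comap.1 (le_sSup h.isSimpleSubmodule_map_mkQ)

theorem socFilt_succ_le {k : ℕ} {X : Submodule R M} (hX : socFilt σ k ≤ X)
    (h : ∀ D, IsIrredSubquot σ (socFilt σ k) D → D ≤ X) : socFilt σ (k + 1) ≤ X := by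
  have hX' : (X.map (socFilt σ k).mkQ).comap (socFilt σ k).mkQ = X := by
    rw [Submodule.comap_map_mkQ, sup_eq_right.2 hX]
  rw [← hX']
  refine Submodule.comap_mono (sSup_le fun Y hY => ?_)
  rw [← Submodule.map_comap_eq_of_surjective (socFilt σ k).mkQ_surjective Y]
  exact Submodule.map_mono (h _ (IsSimpleSubmodule.isIrredSubquot_comap_mkQ
    (actStable_socFilt k) hY))

/-- The image `D / P` of `D` in the subquotient `Q / P`. -/
def subQuotImage (P Q D : Submodule R M) : Submodule R (SubQuot P Q) :=
  (D.comap Q.subtype).map (P.comap Q.subtype).mkQ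

theorem mkQ_mem_subQuotImage {P Q D : Submodule R M} (hPD : P ≤ D) {x : Q} :
    (P.comap Q.subtype).mkQ x ∈ subQuotImage P Q D ↔ (x : M) ∈ D := by
  rw [← Submodule.mem_comap, subQuotImage, Submodule.comap_map_mkQ,
    sup_eq_right.2 (Submodule.comap_mono hPD), Submodule.mem_comap, Submodule.subtype_apply]

theorem ActStable.image {P Q D : Submodule R M} (hP : ActStable σ P)
    (hQ : ActStable σ Q) (hD : ActStable σ D) :
    ActStable (subQuotMap σ P Q) (subQuotImage P Q D) := by
  rintro g _ ⟨x, hx, rfl⟩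
  rw [subQuotMap_mkQ hP hQ]
  exact ⟨_, hD g x hx, rfl⟩

/-- The preimage in `M` of a submodule of the subquotient `Q / P`. -/
def subQuotPreimage (P Q : Submodule R M) (Y : Submodule R (SubQuot P Q)) : Submodule R M :=
  (Y.comap (P.comap Q.subtype).mkQ).map Q.subtype

theorem mem_subQuotPreimage {P Q : Submodule R M} {Y : Submodule R (SubQuot P Q)} {x : Q} :
    (x : M) ∈ subQuotPreimage P Q Y ↔ (P.comap Q.subtype).mkQ x ∈ Y := by
  simp [subQuotPreimage]

theorem subQuotPreimage_le (P Q : Submodule R M) (Y : Submodule R (SubQuot P Q)) :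
    subQuotPreimage P Q Y ≤ Q :=
  Submodule.map_subtype_le _ _

theorem le_subQuotPreimage {P Q : Submodule R M} (hPQ : P ≤ Q)
    (Y : Submodule R (SubQuot P Q)) : P ≤ subQuotPreimage P Q Y := by
  intro x hx
  refine (mem_subQuotPreimage (x := ⟨x, hPQ hx⟩)).2 ?_
  have h0 : (P.comap Q.subtype).mkQ ⟨x, hPQ hx⟩ = 0 := (Submodule.Quotient.mk_eq_zero _).2 hx
  rw [h0]
  exact Y.zero_mem

theorem ActStable.preimage {P Q : Submodule R M} (hP : ActStable σ P)
    (hQ : ActStable σ Q) {Y : Submodule R (SubQuot P Q)} (hY : ActStable (subQuotMap σ P Q) Y) :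
    ActStable σ (subQuotPreimage P Q Y) := by
  intro g x hx
  lift x to Q using subQuotPreimage_le P Q Y hx
  refine (mem_subQuotPreimage (x := ⟨σ g x, hQ g x x.2⟩)).2 ?_
  rw [← subQuotMap_mkQ hP hQ]
  exact hY g _ (mem_subQuotPreimage.1 hx)

theorem subQuotImage_preimage {P Q : Submodule R M} (hPQ : P ≤ Q)
    (Y : Submodule R (SubQuot P Q)) : subQuotImage P Q (subQuotPreimage P Q Y) = Y := by
  ext y
  obtain ⟨x, rfl⟩ := Submodule.mkQ_surjective _ y
  rw [mkQ_mem_subQuotImage (le_subQuotPreimage hPQ Y), mem_subQuotPreimage]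

theorem subQuotPreimage_image {P Q D : Submodule R M} (hPD : P ≤ D) (hDQ : D ≤ Q) :
    subQuotPreimage P Q (subQuotImage P Q D) = D := by
  refine le_antisymm (fun x hx => ?_) fun x hx => ?_
  · lift x to Q using subQuotPreimage_le P Q _ hx
    exact (mkQ_mem_subQuotImage hPD).1 (mem_subQuotPreimage.1 hx)
  · lift x to Q using hDQ hx
    exact mem_subQuotPreimage.2 ((mkQ_mem_subQuotImage hPD).2 hx)

theorem subQuotImage_self (P Q : Submodule R M) : subQuotImage P Q P = ⊥ :=
  Submodule.mkQ_map_self _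

theorem subQuotPreimage_bot {P Q : Submodule R M} (hPQ : P ≤ Q) :
    subQuotPreimage P Q ⊥ = P := by
  rw [← subQuotImage_self, subQuotPreimage_image le_rfl hPQ]

theorem subQuotPreimage_mono {P Q : Submodule R M} {Y Y' : Submodule R (SubQuot P Q)}
    (h : Y ≤ Y') : subQuotPreimage P Q Y ≤ subQuotPreimage P Q Y' :=
  Submodule.map_mono (Submodule.comap_mono h)

theorem subQuotImage_mono (P Q : Submodule R M) {D D' : Submodule R M} (h : D ≤ D') :
    subQuotImage P Q D ≤ subQuotImage P Q D' :=
  Submodule.map_mono (Submodule.comap_mono h)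

theorem IsIrredSubquot.isSimpleSubmodule_subQuotImage {P Q D : Submodule R M}
    (hQ : ActStable σ Q) (h : IsIrredSubquot σ P D) (hDQ : D ≤ Q) :
    IsSimpleSubmodule (subQuotMap σ P Q) (subQuotImage P Q D) := by
  obtain ⟨hP, hD, hlt, hmin⟩ := h
  have hPQ := hlt.le.trans hDQ
  refine ⟨hP.image hQ hD, fun h0 => hlt.ne ?_, fun Y hY hYD => ?_⟩
  · rw [← subQuotPreimage_image hlt.le hDQ, h0, subQuotPreimage_bot hPQ]
  · have hle := subQuotPreimage_mono hYD
    rw [subQuotPreimage_image hlt.le hDQ] at hle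
    refine (hmin _ (hP.preimage hQ hY) (le_subQuotPreimage hPQ Y) hle).imp
      (fun h => ?_) fun h => ?_
    · rw [← subQuotImage_preimage hPQ Y, h, subQuotImage_self]
    · rw [← subQuotImage_preimage hPQ Y, h]

theorem IsSimpleSubmodule.isIrredSubquot_subQuotPreimage {P Q : Submodule R M}
    (hP : ActStable σ P) (hQ : ActStable σ Q) (hPQ : P ≤ Q) {Y : Submodule R (SubQuot P Q)}
    (hY : IsSimpleSubmodule (subQuotMap σ P Q) Y) :
    IsIrredSubquot σ P (subQuotPreimage P Q Y) := by
  obtain ⟨hYs, hne, hmin⟩ := hY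
  refine ⟨hP, hP.preimage hQ hYs,
    lt_of_le_of_ne (le_subQuotPreimage hPQ Y) fun h => hne ?_, fun X hX hPX hXY => ?_⟩
  · rw [← subQuotImage_preimage hPQ Y, ← h, subQuotImage_self]
  · have hX' := subQuotPreimage_image hPX (hXY.trans (subQuotPreimage_le P Q Y))
    have hle := subQuotImage_mono P Q hXY
    rw [subQuotImage_preimage hPQ] at hle
    refine (hmin _ (hP.image hQ hX) hle).imp (fun h => ?_) fun h => ?_
    · rw [← hX', h, subQuotPreimage_bot hPQ]
    · rw [← hX', h]

theorem IsRepIso.symm {N : Type*} [AddCommGroup N] [Module R N] {τ : G → N →ₗ[R] N}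
    (h : IsRepIso σ τ) : IsRepIso τ σ := by
  obtain ⟨e, he⟩ := h
  exact ⟨e.symm, fun g x => by rw [LinearEquiv.symm_apply_eq, he, e.apply_symm_apply]⟩

theorem IsRepIso.trans {N N' : Type*} [AddCommGroup N] [Module R N] [AddCommGroup N']
    [Module R N'] {τ : G → N →ₗ[R] N} {τ' : G → N' →ₗ[R] N'}
    (h : IsRepIso σ τ) (h' : IsRepIso τ τ') : IsRepIso σ τ' := by
  obtain ⟨e, he⟩ := h
  obtain ⟨e', he'⟩ := h'
  exact ⟨e.trans e', fun g x => by simp [he, he']⟩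

/-- First isomorphism theorem for equivariant maps. -/
theorem isRepIso_subQuotMap_of_surjective {N : Type*} [AddCommGroup N] [Module R N]
    {τ : G → N →ₗ[R] N} {P Q : Submodule R M} (hP : ActStable σ P) (hQ : ActStable σ Q)
    (f : Q →ₗ[R] N) (hf : Function.Surjective f) (hker : LinearMap.ker f = P.comap Q.subtype)
    (hcomm : ∀ (g : G) (x : Q), f ⟨σ g x, hQ g x x.2⟩ = τ g (f x)) :
    IsRepIso (subQuotMap σ P Q) τ := by
  refine ⟨(Submodule.quotEquivOfEq _ _ hker.symm).trans (f.quotKerEquivOfSurjective hf),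
    fun g y => ?_⟩
  obtain ⟨x, rfl⟩ := Submodule.mkQ_surjective _ y
  rw [subQuotMap_mkQ hP hQ]
  exact hcomm g x

/-- Second isomorphism theorem for modules with action. -/
theorem isRepIso_subQuotMap_of_inf_sup {A B P Q : Submodule R M} (hA : ActStable σ A)
    (hB : ActStable σ B) (hP : ActStable σ P) (hQ : ActStable σ Q)
    (hinf : B ⊓ P = A) (hsup : B ⊔ P = Q) :
    IsRepIso (subQuotMap σ A B) (subQuotMap σ P Q) := by
  have hBQ : B ≤ Q := hsup ▸ le_sup_left
  have hPQ : P ≤ Q := hsup ▸ le_sup_right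
  refine isRepIso_subQuotMap_of_surjective hA hB
    ((P.comap Q.subtype).mkQ ∘ₗ Submodule.inclusion hBQ) (fun y => ?_) ?_ fun g x => ?_
  · obtain ⟨⟨x, hx⟩, rfl⟩ := Submodule.mkQ_surjective _ y
    obtain ⟨b, hb, p, hp, rfl⟩ := Submodule.mem_sup.1 (hsup ▸ hx)
    refine ⟨⟨b, hb⟩, (Submodule.Quotient.eq _).2 ?_⟩
    simpa using hp
  · ext x
    simp [← hinf]
  · exact (subQuotMap_mkQ hP hQ g (Submodule.inclusion hBQ x)).symm

theorem isRepIso_subQuotMap_subAct {P Q D : Submodule R M} (hP : ActStable σ P)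
    (hQ : ActStable σ Q) (hD : ActStable σ D) (hPD : P ≤ D) (hDQ : D ≤ Q) :
    IsRepIso (subQuotMap σ P D) (subAct (subQuotMap σ P Q) (subQuotImage P Q D)) := by
  refine isRepIso_subQuotMap_of_surjective hP hD
    (((P.comap Q.subtype).mkQ ∘ₗ Submodule.inclusion hDQ).codRestrict (subQuotImage P Q D)
      fun x => (mkQ_mem_subQuotImage hPD).2 x.2) ?_ ?_ fun g x => ?_
  · rintro ⟨_, x, hx, rfl⟩
    exact ⟨⟨x, hx⟩, rfl⟩
  · ext x
    rw [LinearMap.ker_codRestrict]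
    simp
  · refine Subtype.ext ?_
    rw [coe_subAct (hP.image hQ hD)]
    exact (subQuotMap_mkQ hP hQ g (Submodule.inclusion hDQ x)).symm

/-- A simple subquotient `B / A` between consecutive layers of the socle filtration is
isomorphic to a simple submodule `D / socFilt σ k` of the layer. -/
theorem IsIrredSubquot.exists_isRepIso_of_le_socFilt_succ [IsNoetherian R M] {k : ℕ}
    {A B : Submodule R M} (h : IsIrredSubquot σ A B) (hA : socFilt σ k ≤ A)
    (hB : B ≤ socFilt σ (k + 1)) :
    ∃ D, IsIrredSubquot σ (socFilt σ k) D ∧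
      IsRepIso (subQuotMap σ A B) (subQuotMap σ (socFilt σ k) D) := by
  obtain ⟨hAs, hBs, hlt, hmin⟩ := h
  obtain ⟨E, ⟨hE, hAE, hEB⟩, hEmax⟩ := set_has_maximal_iff_noetherian.2 ‹IsNoetherian R M›
    {E : Submodule R M | ActStable σ E ∧ A ≤ E ∧ B ⊓ E ≤ A} ⟨A, hAs, le_rfl, inf_le_right⟩
  have hsup : socFilt σ (k + 1) ≤ B ⊔ E := by
    refine socFilt_succ_le (hA.trans (hAE.trans le_sup_right)) fun D hD => ?_
    rcases hD.2.2.2 (D ⊓ (B ⊔ E)) (hD.2.1.inf (hBs.sup hE))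
      (le_inf hD.2.2.1.le (hA.trans (hAE.trans le_sup_right))) inf_le_left with h0 | h0
    · have hmem : E ⊔ D ∈ {E : Submodule R M | ActStable σ E ∧ A ≤ E ∧ B ⊓ E ≤ A} := by
        refine ⟨hE.sup hD.2.1, hAE.trans le_sup_left, ?_⟩
        rintro x ⟨hxB, hx⟩
        obtain ⟨e, he, d, hd, rfl⟩ := Submodule.mem_sup.1 hx
        have hd' : d ∈ B ⊔ E := by
          have := sub_mem (Submodule.mem_sup_left (T := E) hxB) (Submodule.mem_sup_right he)
          simpa using this
        have hdS : d ∈ socFilt σ k := h0 ▸ ⟨hd, hd'⟩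
        exact hEB ⟨hxB, add_mem he (hAE (hA hdS))⟩
      have : E ⊔ D = E := (eq_of_le_of_not_lt le_sup_left (hEmax _ hmem)).symm
      exact (sup_eq_left.1 this).trans le_sup_right
    · exact inf_eq_left.1 h0
  have hBE : B ⊓ E = A := le_antisymm hEB (le_inf hlt.le hAE)
  obtain ⟨D, hD, hDE⟩ : ∃ D, IsIrredSubquot σ (socFilt σ k) D ∧ ¬ D ≤ E := by
    by_contra! hcon
    have hle : B ≤ E := hB.trans (socFilt_succ_le (hA.trans hAE) hcon)
    exact hlt.ne (by rw [← hBE, inf_eq_left.2 hle])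
  refine ⟨D, hD, ?_⟩
  have hinf : D ⊓ E = socFilt σ k :=
    (hD.2.2.2 _ (hD.2.1.inf hE) (le_inf hD.2.2.1.le (hA.trans hAE)) inf_le_left).resolve_right
      fun h => hDE (inf_eq_left.1 h)
  have hDBE : D ≤ B ⊔ E := hD.le_socFilt_succ.trans hsup
  have hBDE : B ≤ D ⊔ E := by
    rcases hmin (B ⊓ (D ⊔ E)) (hBs.inf (hD.2.1.sup hE))
      (le_inf hlt.le (hAE.trans le_sup_right)) inf_le_left with h0 | h0
    · refine absurd (fun d hd => ?_) hDE
      obtain ⟨b, hb, e, he, rfl⟩ := Submodule.mem_sup.1 (hDBE hd)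
      have hb' : b ∈ D ⊔ E := by
        have := sub_mem (Submodule.mem_sup_left (T := E) hd) (Submodule.mem_sup_right he)
        simpa using this
      exact add_mem (hAE (h0 ▸ ⟨hb, hb'⟩)) he
    · exact inf_eq_left.1 h0
  have hDB : D ⊔ E = B ⊔ E :=
    le_antisymm (sup_le hDBE le_sup_right) (sup_le hBDE le_sup_right)
  exact (isRepIso_subQuotMap_of_inf_sup hAs hBs hE (hBs.sup hE) hBE rfl).trans
    (isRepIso_subQuotMap_of_inf_sup hD.1 hD.2.1 hE (hBs.sup hE) hinf hDB).symm

/-- Every simple subquotient `Z / socFilt σ (k + 1)` can be realised as the top of a subquotient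
`V₂ / V₁` with simple bottom `T / V₁` in the previous layer and no complement to `T / V₁`. -/
theorem IsIrredSubquot.exists_nonsplit [IsNoetherian R M] [IsArtinian R M] {k : ℕ}
    {Z : Submodule R M} (hZ : IsIrredSubquot σ (socFilt σ (k + 1)) Z) :
    ∃ V₁ V₂ T : Submodule R M, IsIrredSubquot σ V₁ T ∧ ActStable σ V₂ ∧
      socFilt σ k ≤ V₁ ∧ V₂ ≤ Z ∧ V₂ ⊓ socFilt σ (k + 1) = T ∧ V₂ ⊔ socFilt σ (k + 1) = Z ∧
      ¬ ∃ C : Submodule R M, ActStable σ C ∧ V₁ ≤ C ∧ C ≤ V₂ ∧ C ⊓ T = V₁ ∧ C ⊔ T = V₂ := by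
  have hS := socFilt_le_succ (σ := σ) k
  have hS0 := actStable_socFilt (σ := σ) k
  obtain ⟨hS1, hZs, hlt, hmin⟩ := hZ
  obtain ⟨A, ⟨hA, hSA, hAZ, hAS⟩, hAmin⟩ := IsArtinian.set_has_minimal
    {A : Submodule R M | ActStable σ A ∧ socFilt σ k ≤ A ∧ A ≤ Z ∧ ¬ A ≤ socFilt σ (k + 1)}
    ⟨Z, hZs, hS.trans hlt.le, le_rfl, hlt.not_ge⟩
  have hAC : ∀ C, ActStable σ C → socFilt σ k ≤ C → C ≤ A →
      C ≤ A ⊓ socFilt σ (k + 1) ∨ C = A := by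
    intro C hC hSC hCA
    by_cases hCS : C ≤ socFilt σ (k + 1)
    · exact Or.inl (le_inf hCA hCS)
    · exact Or.inr (eq_of_le_of_not_lt hCA (hAmin C ⟨hC, hSC, hCA.trans hAZ, hCS⟩))
  have hne : socFilt σ k ≠ A ⊓ socFilt σ (k + 1) := by
    intro h
    refine hAS (IsIrredSubquot.le_socFilt_succ ⟨hS0, hA, lt_of_le_of_ne hSA ?_, ?_⟩)
    · rintro h'
      exact hAS (h' ▸ hS)
    · intro C hC hSC hCA
      exact (hAC C hC hSC hCA).imp_left fun h' => le_antisymm (h ▸ h') hSC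
  obtain ⟨V, ⟨hV, hSV, hVT⟩, hVmax⟩ := set_has_maximal_iff_noetherian.2 ‹IsNoetherian R M›
    {V : Submodule R M | ActStable σ V ∧ socFilt σ k ≤ V ∧ V < A ⊓ socFilt σ (k + 1)}
    ⟨_, hS0, le_rfl, lt_of_le_of_ne (le_inf hSA hS) hne⟩
  refine ⟨V, A, A ⊓ socFilt σ (k + 1), ⟨hV, hA.inf hS1, hVT, fun Y hY hVY hYT => ?_⟩, hA, hSV,
    hAZ, rfl, ?_, ?_⟩
  · rcases hYT.lt_or_eq with h | h
    · exact Or.inl (eq_of_le_of_not_lt hVY (hVmax Y ⟨hY, hSV.trans hVY, h⟩)).symm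
    · exact Or.inr h
  · exact (hmin _ (hA.sup hS1) le_sup_right (sup_le hAZ hlt.le)).resolve_left
      fun h => hAS (sup_eq_right.1 h)
  · rintro ⟨C, hC, hVC, hCA, hinf, hsup⟩
    rcases hAC C hC (hSV.trans hVC) hCA with h | rfl
    · rw [sup_eq_right.2 h] at hsup
      exact hAS (inf_eq_left.1 hsup)
    · rw [← inf_assoc, inf_idem] at hinf
      exact hVT.ne hinf.symm

end Subquotients

section Statement

variable {F : Type*} [Field F] {G : Type*} [Group G]
variable {M : Type*} [AddCommGroup M] [Module F M] [FiniteDimensional F M]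

theorem statement_10 (σ : Representation F G M) (m : ℕ) (hm : 2 ≤ m)
    (W : Submodule F (SubQuot (socFilt (ofRep σ) (m - 1)) (socFilt (ofRep σ) m)))
    (hW : IsSimpleSubmodule
      (subQuotMap (ofRep σ) (socFilt (ofRep σ) (m - 1)) (socFilt (ofRep σ) m)) W) :
    ∃ U : Submodule F (SubQuot (socFilt (ofRep σ) (m - 2)) (socFilt (ofRep σ) (m - 1))),
      IsSimpleSubmodule
        (subQuotMap (ofRep σ) (socFilt (ofRep σ) (m - 2)) (socFilt (ofRep σ) (m - 1))) U ∧
      ∃ V₁ V₂ T : Submodule F M,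
        ActStable (ofRep σ) V₁ ∧ ActStable (ofRep σ) V₂ ∧ ActStable (ofRep σ) T ∧
        socFilt (ofRep σ) (m - 2) ≤ V₁ ∧ V₁ ≤ socFilt (ofRep σ) (m - 1) ∧
        V₂ ≤ socFilt (ofRep σ) m ∧ V₁ ≤ T ∧ T ≤ V₂ ∧
        IsRepIso (subQuotMap (ofRep σ) V₁ T)
          (subAct (subQuotMap (ofRep σ) (socFilt (ofRep σ) (m - 2))
            (socFilt (ofRep σ) (m - 1))) U) ∧
        IsRepIso (subQuotMap (ofRep σ) T V₂)
          (subAct (subQuotMap (ofRep σ) (socFilt (ofRep σ) (m - 1))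
            (socFilt (ofRep σ) m)) W) ∧
        ¬ ∃ C : Submodule F M, ActStable (ofRep σ) C ∧ V₁ ≤ C ∧ C ≤ V₂ ∧
            C ⊓ T = V₁ ∧ C ⊔ T = V₂ := by
  obtain ⟨k, rfl⟩ := Nat.exists_eq_add_of_le' hm
  change Submodule F (SubQuot (socFilt (ofRep σ) (k + 1)) (socFilt (ofRep σ) (k + 2))) at W
  change IsSimpleSubmodule
    (subQuotMap (ofRep σ) (socFilt (ofRep σ) (k + 1)) (socFilt (ofRep σ) (k + 2))) W at hW
  change ∃ U : Submodule F (SubQuot (socFilt (ofRep σ) k) (socFilt (ofRep σ) (k + 1))), _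
  have hS := actStable_socFilt (σ := ofRep σ)
  have hle := socFilt_le_succ (σ := ofRep σ)
  have hZ := hW.isIrredSubquot_subQuotPreimage (hS _) (hS _) (hle (k + 1))
  have hZle := subQuotPreimage_le _ _ W
  have hWZ := isRepIso_subQuotMap_subAct (hS (k + 1)) (hS (k + 2)) hZ.2.1 hZ.2.2.1.le hZle
  rw [subQuotImage_preimage (hle (k + 1))] at hWZ
  obtain ⟨V₁, V₂, T, hT, hV₂, hSV, hVZ, hinf, hsup, hsplit⟩ := hZ.exists_nonsplit
  have hTS : T ≤ socFilt (ofRep σ) (k + 1) := hinf ▸ inf_le_right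
  obtain ⟨D, hD, hTD⟩ := hT.exists_isRepIso_of_le_socFilt_succ hSV hTS
  exact ⟨subQuotImage _ _ D, hD.isSimpleSubmodule_subQuotImage (hS _) hD.le_socFilt_succ,
    V₁, V₂, T, hT.1, hV₂, hT.2.1, hSV, hT.2.2.1.le.trans hTS, hVZ.trans hZle, hT.2.2.1.le,
    hinf ▸ inf_le_left,
    hTD.trans (isRepIso_subQuotMap_subAct (hS _) (hS _) hD.2.1 hD.2.2.1.le hD.le_socFilt_succ),
    (isRepIso_subQuotMap_of_inf_sup hT.2.1 hV₂ (hS _) hZ.2.1 hinf hsup).trans hWZ, hsplit⟩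

end Statement
end
end
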